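/- In every sort of ordinal functional, any two elements f, g have a common strict upper bound (an h with f < h and g < h), and every <-increasing sequence f₀ < f₁ < f₂ < ⋯ indexed by ℕ has a strict upper bound (an f with f_n < f for all n). -/

import Mathlib

namespace PMP

/-- Sorts of ordinal functionals: `ord` is the sort of ordinals, `fn θ θ'` the sort of
functions from sort `θ` to sort `θ'`, and `prod I f` the product of the sorts `f i` over
the index set `I`. -/
inductive OSort : Type 1 where
  | ord : OSort
  | fn : OSort → OSort → OSort
  | prod : (I : Type) → (I → OSort) → OSort

/-- The interpretation of a sort, together with the relation `<` on it, defined by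
simultaneous recursion: on `ord` the interpretation is the ordinals with the usual order;
on `fn θ θ'` it is the full function space, with `f < g` iff there is an `a` of sort `θ`
such that `f b < g b` for every `b` of sort `θ` with `a < b`; on a product it is the
product type, with the pointwise (everywhere) comparison. -/
noncomputable def OSort.data : OSort → (T : Type 1) × (T → T → Prop)
  | .ord => ⟨Ordinal, fun a b => a < b⟩
  | .fn θ θ' => ⟨θ.data.1 → θ'.data.1,
      fun f g => ∃ a : θ.data.1, ∀ b : θ.data.1, θ.data.2 a b → θ'.data.2 (f b) (g b)⟩
  | .prod I f => ⟨(i : I) → (f i).data.1, fun x y => ∀ i : I, (f i).data.2 (x i) (y i)⟩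

/-- The interpretation (carrier) of a sort. -/
noncomputable def OSort.interp (θ : OSort) : Type 1 := θ.data.1

/-- The order `<` on (the interpretation of) a sort. -/
noncomputable def OSort.lt (θ : OSort) : θ.interp → θ.interp → Prop := θ.data.2

theorem OSort.nonempty_data (θ : OSort) : Nonempty θ.data.1 := by
  induction θ with
  | ord => exact ⟨(0 : Ordinal.{0})⟩
  | fn θ θ' _ ih' => exact ih'.elim fun x => ⟨fun _ => x⟩
  | prod I f ih => exact ⟨fun i => (ih i).some⟩

theorem OSort.countable_bound (θ : OSort) :
    ∀ F : ℕ → θ.data.1, ∃ f : θ.data.1, ∀ n : ℕ, θ.data.2 (F n) f := by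
  induction θ with
  | ord =>
    intro F
    let G : ℕ → Ordinal.{0} := F
    refine ⟨(Order.succ (⨆ n, G n) : Ordinal.{0}), fun n => ?_⟩
    have h : G n < Order.succ (⨆ n, G n) := Order.lt_succ_of_le (Ordinal.le_iSup G n)
    exact h
  | fn θ θ' _ ih' =>
    intro F
    choose f hf using fun b : θ.data.1 => ih' (fun n => F n b)
    exact ⟨f, fun n => ⟨(OSort.nonempty_data θ).some, fun b _ => hf b n⟩⟩
  | prod I f ih =>
    intro F
    choose g hg using fun i : I => ih i (fun n => F n i)
    exact ⟨g, fun n i => hg i n⟩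

/-- In every sort of ordinal functional, any two elements have a common strict upper
bound, and every `<`-increasing ℕ-indexed sequence has a strict upper bound. -/
theorem pairs_and_chains_have_upper_bounds (θ : OSort) :
    (∀ f g : θ.interp, ∃ h : θ.interp, θ.lt f h ∧ θ.lt g h) ∧
    (∀ F : ℕ → θ.interp, (∀ n : ℕ, θ.lt (F n) (F (n + 1))) →
      ∃ f : θ.interp, ∀ n : ℕ, θ.lt (F n) f) := by
  refine ⟨fun f g => ?_, fun F _ => OSort.countable_bound θ F⟩
  obtain ⟨h, hh⟩ := OSort.countable_bound θ (fun n => if n = 0 then f else g)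
  exact ⟨h, hh 0, hh 1⟩

end PMP
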